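/- Fix d ≥ 2, R > 0 and β < 1/2 with β ≥ 0. For every δ > 0 there exists E₀ ≥ 1 such that the following holds for all E ≥ E₀: whenever Ω, ∂Ω, σ, n, q are as in the context with Ω contained in the closed ball of radius R centered at the origin, and φ, ψ : ℝ^d → ℝ are C² on a neighborhood of the closure of Ω, satisfy −Δφ = E_φ·φ and −Δψ = E_ψ·ψ on Ω with |E_φ − E| ≤ E^β and |E_ψ − E| ≤ E^β, satisfy ∫_Ω φ(x)² dx = 1 and either φ = ψ or (∫_Ω ψ(x)² dx = 1 and ∫_Ω φ(x)·ψ(x) dx = 0), and both satisfy the mixed homogeneous boundary conditions (there are Γ_D ⊆ ∂Ω and γ : ∂Ω → ℝ with φ, ψ vanishing on Γ_D and γ·φ + ⟨n,∇φ⟩ = 0, γ·ψ + ⟨n,∇ψ⟩ = 0 on ∂Ω ∖ Γ_D), then |q(φ,ψ; E_φ+E_ψ)/(2E) − (1 if φ = ψ, 0 otherwise)| ≤ δ. -/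

import Mathlib

open MeasureTheory
open scoped RealInnerProductSpace Classical

noncomputable section

/-- The Euclidean Laplacian: the sum of the second partial derivatives. -/
def lap {d : ℕ} (u : EuclideanSpace ℝ (Fin d) → ℝ) (x : EuclideanSpace ℝ (Fin d)) : ℝ :=
  ∑ i, fderiv ℝ (fun y => fderiv ℝ u y (EuclideanSpace.single i (1:ℝ))) x
    (EuclideanSpace.single i (1:ℝ))

/-- The divergence: the sum of the partial derivatives of the components. -/
def divg {d : ℕ} (F : EuclideanSpace ℝ (Fin d) → EuclideanSpace ℝ (Fin d))
    (x : EuclideanSpace ℝ (Fin d)) : ℝ :=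
  ∑ i, fderiv ℝ (fun y => ⟪F y, EuclideanSpace.single i (1:ℝ)⟫) x
    (EuclideanSpace.single i (1:ℝ))

/-- The boundary bilinear form `q(u, v; 𝓔)`. -/
def qform (d : ℕ) (Ω : Set (EuclideanSpace ℝ (Fin d)))
    (n : EuclideanSpace ℝ (Fin d) → EuclideanSpace ℝ (Fin d))
    (u v : EuclideanSpace ℝ (Fin d) → ℝ) (cE : ℝ) : ℝ :=
  ∫ x in frontier Ω,
    (((d : ℝ) - 2) / 2 * (⟪n x, gradient u x⟫ * v x + ⟪n x, gradient v x⟫ * u x)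
      + ⟪x, n x⟫ * (cE / 2 * u x * v x - ⟪gradient u x, gradient v x⟫)
      + ⟪x, gradient u x⟫ * ⟪n x, gradient v x⟫
      + ⟪x, gradient v x⟫ * ⟪n x, gradient u x⟫) ∂(μH[(d:ℝ) - 1])

/-- The combined vector field. -/
def Fld {d : ℕ} (u v : EuclideanSpace ℝ (Fin d) → ℝ) (c k : ℝ)
    (x : EuclideanSpace ℝ (Fin d)) : EuclideanSpace ℝ (Fin d) :=
  (((d : ℝ) - 2) / 2) • (v x • gradient u x + u x • gradient v x)
    + (c / 2 * u x * v x - ⟪gradient u x, gradient v x⟫) • x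
    + ⟪x, gradient u x⟫ • gradient v x
    + ⟪x, gradient v x⟫ • gradient u x
    - (k * ⟪x, x⟫) • (v x • gradient u x - u x • gradient v x)

lemma contDiffOn_gradient {d : ℕ} {u : EuclideanSpace ℝ (Fin d) → ℝ}
    {U : Set (EuclideanSpace ℝ (Fin d))} (hU : IsOpen U) (hu : ContDiffOn ℝ 2 u U) :
    ContDiffOn ℝ 1 (gradient u) U := by
  have h := hu.fderiv_of_isOpen (m := 1) hU (by norm_num)
  exact (InnerProductSpace.toDual ℝ
    (EuclideanSpace ℝ (Fin d))).symm.toContinuousLinearEquiv.contDiff.comp_contDiffOn h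

lemma contDiffOn_Fld {d : ℕ} {u v : EuclideanSpace ℝ (Fin d) → ℝ} (c k : ℝ)
    {U : Set (EuclideanSpace ℝ (Fin d))} (hU : IsOpen U) (hu : ContDiffOn ℝ 2 u U)
    (hv : ContDiffOn ℝ 2 v U) : ContDiffOn ℝ 1 (Fld u v c k) U := by
  have gu := contDiffOn_gradient hU hu
  have gv := contDiffOn_gradient hU hv
  have hu1 : ContDiffOn ℝ 1 u U := hu.of_le (by norm_num)
  have hv1 : ContDiffOn ℝ 1 v U := hv.of_le (by norm_num)
  have hx : ContDiffOn ℝ 1 (fun x : EuclideanSpace ℝ (Fin d) => x) U := contDiffOn_id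
  have cst : ∀ a : ℝ, ContDiffOn ℝ 1 (fun _ : EuclideanSpace ℝ (Fin d) => a) U :=
    fun a => contDiffOn_const
  exact (((((cst _).smul ((hv1.smul gu).add (hu1.smul gv))).add
    (((((cst _).mul hu1).mul hv1).sub (gu.inner ℝ gv)).smul hx)).add
    ((hx.inner ℝ gu).smul gv)).add ((hx.inner ℝ gv).smul gu)).sub
    (((cst k).mul (hx.inner ℝ hx)).smul ((hv1.smul gu).sub (hu1.smul gv)))

lemma gradient_apply' {d : ℕ} (u : EuclideanSpace ℝ (Fin d) → ℝ)
    (x : EuclideanSpace ℝ (Fin d)) (i : Fin d) :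
    gradient u x i = fderiv ℝ u x (EuclideanSpace.single i (1:ℝ)) := by
  have : ⟪gradient u x, EuclideanSpace.single i (1:ℝ)⟫
      = fderiv ℝ u x (EuclideanSpace.single i (1:ℝ)) := by
    simp [gradient, InnerProductSpace.toDual_symm_apply]
  rw [← this, EuclideanSpace.inner_single_right]
  simp only [one_mul, conj_trivial]

lemma inner_sum' {d : ℕ} (x y : EuclideanSpace ℝ (Fin d)) : ⟪x, y⟫ = ∑ i, x i * y i := by
  simp [PiLp.inner_apply, mul_comm]

/-- second derivative data -/
lemma snd_data {d : ℕ} {u : EuclideanSpace ℝ (Fin d) → ℝ}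
    {U : Set (EuclideanSpace ℝ (Fin d))} (hU : IsOpen U) (hu : ContDiffOn ℝ 2 u U)
    {x : EuclideanSpace ℝ (Fin d)} (hx : x ∈ U) :
    ∃ P : Fin d → (EuclideanSpace ℝ (Fin d) →L[ℝ] ℝ),
      (∀ i, HasFDerivAt (fun y => fderiv ℝ u y (EuclideanSpace.single i (1:ℝ))) (P i) x) ∧
      (∀ i j, P i (EuclideanSpace.single j 1) = P j (EuclideanSpace.single i 1)) ∧
      ∑ i, P i (EuclideanSpace.single i 1) = lap u x := by
  have h2 : ContDiffAt ℝ 2 u x := hu.contDiffAt (hU.mem_nhds hx)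
  have hd : DifferentiableAt ℝ (fderiv ℝ u) x :=
    (h2.fderiv_right (m := 1) (by norm_num)).differentiableAt (by norm_num)
  have hP : ∀ i : Fin d, HasFDerivAt (fun y => fderiv ℝ u y (EuclideanSpace.single i (1:ℝ)))
      ((fderiv ℝ (fderiv ℝ u) x).flip (EuclideanSpace.single i (1:ℝ))) x := by
    intro i
    have := hd.hasFDerivAt.clm_apply (hasFDerivAt_const (EuclideanSpace.single i (1:ℝ)) x)
    rwa [ContinuousLinearMap.comp_zero, zero_add] at this
  refine ⟨_, hP, ?_, ?_⟩
  · intro i j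
    have := h2.isSymmSndFDerivAt (by simp)
    simpa using this.eq _ _
  · unfold lap
    exact Finset.sum_congr rfl fun i _ => by rw [(hP i).fderiv]

lemma divg_Fld {d : ℕ} {u v : EuclideanSpace ℝ (Fin d) → ℝ} (c k : ℝ)
    {U : Set (EuclideanSpace ℝ (Fin d))} (hU : IsOpen U) (hu : ContDiffOn ℝ 2 u U)
    (hv : ContDiffOn ℝ 2 v U) {x : EuclideanSpace ℝ (Fin d)} (hx : x ∈ U) :
    divg (Fld u v c k) x = ((d : ℝ) - 2) / 2 * (v x * lap u x + u x * lap v x)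
      + d * (c / 2 * u x * v x) + c / 2 * (v x * ⟪x, gradient u x⟫ + u x * ⟪x, gradient v x⟫)
      + ⟪x, gradient u x⟫ * lap v x + ⟪x, gradient v x⟫ * lap u x
      - 2 * k * (v x * ⟪x, gradient u x⟫ - u x * ⟪x, gradient v x⟫)
      - k * ⟪x, x⟫ * (v x * lap u x - u x * lap v x) := by
  obtain ⟨P, hP, sP, lP⟩ := snd_data hU hu hx
  obtain ⟨Q, hQ, sQ, lQ⟩ := snd_data hU hv hx
  have du : HasFDerivAt u (fderiv ℝ u x) x :=
    ((hu.contDiffAt (hU.mem_nhds hx)).differentiableAt (by norm_num)).hasFDerivAt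
  have dv : HasFDerivAt v (fderiv ℝ v x) x :=
    ((hv.contDiffAt (hU.mem_nhds hx)).differentiableAt (by norm_num)).hasFDerivAt
  have dx : ∀ i : Fin d, HasFDerivAt (fun y : EuclideanSpace ℝ (Fin d) => y i)
      (EuclideanSpace.proj i : EuclideanSpace ℝ (Fin d) →L[ℝ] ℝ) x := fun i =>
    (EuclideanSpace.proj i : EuclideanSpace ℝ (Fin d) →L[ℝ] ℝ).hasFDerivAt
  have key : ∀ i : Fin d, fderiv ℝ (fun y => ⟪Fld u v c k y, EuclideanSpace.single i (1:ℝ)⟫) x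
      (EuclideanSpace.single i (1:ℝ)) =
      ((d : ℝ) - 2) / 2 * (2 * (gradient u x i * gradient v x i)
          + v x * P i (EuclideanSpace.single i 1) + u x * Q i (EuclideanSpace.single i 1))
      + (c / 2 * u x * v x - ∑ j, gradient u x j * gradient v x j)
      + (c / 2 * (v x * (x i * gradient u x i) + u x * (x i * gradient v x i))
        - ∑ j, (x i * gradient v x j * P j (EuclideanSpace.single i 1))
        - ∑ j, (x i * gradient u x j * Q j (EuclideanSpace.single i 1)))
      + (gradient u x i * gradient v x i
        + ∑ j, x j * gradient v x i * P j (EuclideanSpace.single i 1))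
      + (∑ j, x j * gradient u x j) * Q i (EuclideanSpace.single i 1)
      + (gradient v x i * gradient u x i
        + ∑ j, x j * gradient u x i * Q j (EuclideanSpace.single i 1))
      + (∑ j, x j * gradient v x j) * P i (EuclideanSpace.single i 1)
      - 2 * k * (v x * (x i * gradient u x i) - u x * (x i * gradient v x i))
      - k * (∑ j, x j * x j) * (v x * P i (EuclideanSpace.single i 1)
          - u x * Q i (EuclideanSpace.single i 1)) := by
    intro i
    have e1 : (fun y => ⟪Fld u v c k y, EuclideanSpace.single i (1:ℝ)⟫) = fun y =>
        (((d : ℝ) - 2) / 2) * (v y * fderiv ℝ u y (EuclideanSpace.single i (1:ℝ))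
            + u y * fderiv ℝ v y (EuclideanSpace.single i (1:ℝ)))
        + (c / 2 * u y * v y - ∑ j, fderiv ℝ u y (EuclideanSpace.single j (1:ℝ))
            * fderiv ℝ v y (EuclideanSpace.single j (1:ℝ))) * y i
        + (∑ j, y j * fderiv ℝ u y (EuclideanSpace.single j (1:ℝ)))
            * fderiv ℝ v y (EuclideanSpace.single i (1:ℝ))
        + (∑ j, y j * fderiv ℝ v y (EuclideanSpace.single j (1:ℝ)))
            * fderiv ℝ u y (EuclideanSpace.single i (1:ℝ))
        - (k * ∑ j, y j * y j) * (v y * fderiv ℝ u y (EuclideanSpace.single i (1:ℝ))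
            - u y * fderiv ℝ v y (EuclideanSpace.single i (1:ℝ))) := by
      funext y
      rw [EuclideanSpace.inner_single_right]
      simp only [Fld, inner_sum', PiLp.add_apply, PiLp.sub_apply, PiLp.smul_apply, smul_eq_mul,
        gradient_apply', one_mul, conj_trivial]
    rw [e1]
    have s1 := HasFDerivAt.fun_sum (u := Finset.univ) fun j _ => (hP j).mul (hQ j)
    have s2 := HasFDerivAt.fun_sum (u := Finset.univ) fun j _ => (dx j).mul (hP j)
    have s3 := HasFDerivAt.fun_sum (u := Finset.univ) fun j _ => (dx j).mul (hQ j)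
    have s4 := HasFDerivAt.fun_sum (u := Finset.univ) fun j _ => (dx j).mul (dx j)
    have H := ((((((dv.mul (hP i)).add (du.mul (hQ i))).const_mul (((d : ℝ) - 2) / 2)).add
      ((((du.const_mul (c / 2)).mul dv).sub s1).mul (dx i))).add (s2.mul (hQ i))).add
      (s3.mul (hP i))).sub ((s4.const_mul k).mul ((dv.mul (hP i)).sub (du.mul (hQ i))))
    erw [H.fderiv]
    simp only [gradient_apply']
    simp [Finset.sum_add_distrib, PiLp.single_apply]
    have r : ∀ (a : ℝ) (f g : Fin d → ℝ), ∑ j, a * f j * g j = a * ∑ j, f j * g j := by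
      intro a f g
      rw [Finset.mul_sum]
      exact Finset.sum_congr rfl fun j _ => by ring
    have r' : ∀ (a : ℝ) (f g : Fin d → ℝ), ∑ j, f j * a * g j = a * ∑ j, f j * g j := by
      intro a f g
      rw [Finset.mul_sum]
      exact Finset.sum_congr rfl fun j _ => by ring
    rw [r, r, r', r']
    ring
  unfold divg
  rw [Finset.sum_congr rfl fun i _ => key i]
  have t1 : ∑ i, ∑ j, x i * gradient v x j * P j (EuclideanSpace.single i 1)
      = ∑ i, ∑ j, x j * gradient v x i * P j (EuclideanSpace.single i 1) := by
    rw [Finset.sum_comm]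
    exact Finset.sum_congr rfl fun i _ => Finset.sum_congr rfl fun j _ => by rw [sP]
  have t2 : ∑ i, ∑ j, x i * gradient u x j * Q j (EuclideanSpace.single i 1)
      = ∑ i, ∑ j, x j * gradient u x i * Q j (EuclideanSpace.single i 1) := by
    rw [Finset.sum_comm]
    exact Finset.sum_congr rfl fun i _ => Finset.sum_congr rfl fun j _ => by rw [sQ]
  have t3 : ∑ i, gradient v x i * gradient u x i = ∑ i, gradient u x i * gradient v x i :=
    Finset.sum_congr rfl fun i _ => mul_comm _ _
  simp only [Finset.sum_add_distrib, Finset.sum_sub_distrib, ← Finset.mul_sum, t1, t2, t3, lP, lQ,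
    inner_sum', Finset.sum_const, Finset.card_univ, Fintype.card_fin, nsmul_eq_mul]
  ring

set_option maxHeartbeats 1000000 in
theorem asymptotic_orthogonality
    (d : ℕ) (hd : 2 ≤ d) (R : ℝ) (hR : 0 < R) (β : ℝ) (hβ0 : 0 ≤ β) (hβ : β < 1 / 2) :
    ∀ δ > 0, ∃ E₀ ≥ (1 : ℝ), ∀ En ≥ E₀,
      ∀ (Ω : Set (EuclideanSpace ℝ (Fin d))) (n : EuclideanSpace ℝ (Fin d) → EuclideanSpace ℝ (Fin d))
        (φ ψ : EuclideanSpace ℝ (Fin d) → ℝ) (Eφ Eψ : ℝ),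
        IsOpen Ω → Bornology.IsBounded Ω → Ω ⊆ Metric.closedBall 0 R →
        (∀ F : EuclideanSpace ℝ (Fin d) → EuclideanSpace ℝ (Fin d),
          (∃ U, IsOpen U ∧ closure Ω ⊆ U ∧ ContDiffOn ℝ 1 F U) →
          (∫ x in Ω, divg F x) = ∫ x in frontier Ω, ⟪F x, n x⟫ ∂(μH[(d:ℝ) - 1])) →
        (∃ U, IsOpen U ∧ closure Ω ⊆ U ∧ ContDiffOn ℝ 2 φ U) →
        (∃ U, IsOpen U ∧ closure Ω ⊆ U ∧ ContDiffOn ℝ 2 ψ U) →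
        (∀ x ∈ Ω, -lap φ x = Eφ * φ x) →
        (∀ x ∈ Ω, -lap ψ x = Eψ * ψ x) →
        |Eφ - En| ≤ En ^ β → |Eψ - En| ≤ En ^ β →
        (∫ x in Ω, (φ x) ^ 2) = 1 →
        (φ = ψ ∨ ((∫ x in Ω, (ψ x) ^ 2) = 1 ∧ (∫ x in Ω, φ x * ψ x) = 0)) →
        (∃ ΓD ⊆ frontier Ω, ∃ γ : EuclideanSpace ℝ (Fin d) → ℝ,
          (∀ x ∈ ΓD, φ x = 0 ∧ ψ x = 0) ∧
          ∀ x ∈ frontier Ω \ ΓD,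
            γ x * φ x + ⟪n x, gradient φ x⟫ = 0 ∧
            γ x * ψ x + ⟪n x, gradient ψ x⟫ = 0) →
        |qform d Ω n φ ψ (Eφ + Eψ) / (2 * En) - (if φ = ψ then 1 else 0)| ≤ δ := by
  intro δ hδ
  have hlim : Filter.Tendsto (fun t : ℝ => (1 + R ^ 2) * t ^ (-(1 - 2 * β))) Filter.atTop
      (nhds ((1 + R ^ 2) * 0)) :=
    (tendsto_rpow_neg_atTop (by linarith)).const_mul _
  rw [mul_zero] at hlim
  obtain ⟨E₁, hE₁⟩ := Filter.eventually_atTop.1 (hlim.eventually (gt_mem_nhds hδ))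
  refine ⟨max 1 E₁, le_max_left _ _, ?_⟩
  intro En hEn Ω n φ ψ Eφ Eψ hΩo hΩb hΩR hGG hφ hψ eφ eψ hEφ hEψ nφ hor hbc
  have hEn1 : 1 ≤ En := (le_max_left _ _).trans hEn
  have hsmall := hE₁ En ((le_max_right _ _).trans hEn)
  obtain ⟨U₁, oU₁, cU₁, sφ⟩ := hφ
  obtain ⟨U₂, oU₂, cU₂, sψ⟩ := hψ
  have oU := oU₁.inter oU₂
  have cU : closure Ω ⊆ U₁ ∩ U₂ := Set.subset_inter cU₁ cU₂
  have sφ' := sφ.mono (Set.inter_subset_left (t := U₂))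
  have sψ' := sψ.mono (Set.inter_subset_right (s := U₁))
  set k : ℝ := (Eφ - Eψ) / 4 with hk
  have hgg := hGG (Fld φ ψ (Eφ + Eψ) k) ⟨_, oU, cU, contDiffOn_Fld _ _ oU sφ' sψ'⟩
  have hq : qform d Ω n φ ψ (Eφ + Eψ)
      = ∫ x in frontier Ω, ⟪Fld φ ψ (Eφ + Eψ) k x, n x⟫ ∂(μH[(d:ℝ) - 1]) := by
    unfold qform
    refine setIntegral_congr_fun isClosed_frontier.measurableSet fun x hx => ?_
    obtain ⟨ΓD, -, γ, hD, hN⟩ := hbc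
    have w : ψ x * ⟪n x, gradient φ x⟫ - φ x * ⟪n x, gradient ψ x⟫ = 0 := by
      by_cases hxD : x ∈ ΓD
      · rw [(hD x hxD).1, (hD x hxD).2]; ring
      · obtain ⟨h1, h2⟩ := hN x ⟨hx, hxD⟩
        linear_combination ψ x * h1 - φ x * h2
    simp only [Fld, inner_add_left, inner_sub_left, real_inner_smul_left]
    rw [real_inner_comm (n x) (gradient φ x), real_inner_comm (n x) (gradient ψ x)]
    linear_combination (k * ⟪x, x⟫) * w
  have hdiv : (∫ x in Ω, divg (Fld φ ψ (Eφ + Eψ) k) x)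
      = ∫ x in Ω, ((Eφ + Eψ) * (φ x * ψ x) + (Eφ - Eψ) ^ 2 / 4 * (‖x‖ ^ 2 * (φ x * ψ x))) := by
    refine setIntegral_congr_fun hΩo.measurableSet fun x hx => ?_
    have lφ : lap φ x = -(Eφ * φ x) := by rw [← eφ x hx, neg_neg]
    have lψ : lap ψ x = -(Eψ * ψ x) := by rw [← eψ x hx, neg_neg]
    have h := divg_Fld (Eφ + Eψ) k oU sφ' sψ' (cU (subset_closure hx))
    rw [lφ, lψ, real_inner_self_eq_norm_sq] at h
    refine h.trans ?_
    rw [hk]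
    ring
  have hcomp : IsCompact (closure Ω) := hΩb.isCompact_closure
  have cφ : ContinuousOn φ (closure Ω) := sφ.continuousOn.mono cU₁
  have cψ : ContinuousOn ψ (closure Ω) := sψ.continuousOn.mono cU₂
  have int : ∀ f : EuclideanSpace ℝ (Fin d) → ℝ, ContinuousOn f (closure Ω) →
      IntegrableOn f Ω volume := fun f hf =>
    (hf.integrableOn_compact hcomp).mono_set subset_closure
  have i1 := int (fun x => φ x * ψ x) (cφ.mul cψ)
  have i2 := int (fun x => ‖x‖ ^ 2 * (φ x * ψ x))
    ((continuous_norm.pow 2).continuousOn.mul (cφ.mul cψ))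
  have iφ := int (fun x => φ x ^ 2) (cφ.pow 2)
  have iψ := int (fun x => ψ x ^ 2) (cψ.pow 2)
  have hQ : qform d Ω n φ ψ (Eφ + Eψ) = (Eφ + Eψ) * (∫ x in Ω, φ x * ψ x)
      + (Eφ - Eψ) ^ 2 / 4 * ∫ x in Ω, ‖x‖ ^ 2 * (φ x * ψ x) := by
    rw [hq, ← hgg, hdiv, integral_add (i1.const_mul _) (i2.const_mul _), integral_const_mul,
      integral_const_mul]
  have nψ : (∫ x in Ω, ψ x ^ 2) = 1 := by
    rcases hor with h | h
    · rw [← h]; exact nφ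
    · exact h.1
  have hS : (∫ x in Ω, φ x * ψ x) = if φ = ψ then 1 else 0 := by
    split_ifs with h
    · subst h
      rw [← nφ]
      exact integral_congr_ae (Filter.Eventually.of_forall fun x => (sq (φ x)).symm)
    · exact (hor.resolve_left h).2
  have hT : |∫ x in Ω, ‖x‖ ^ 2 * (φ x * ψ x)| ≤ R ^ 2 := by
    rw [← Real.norm_eq_abs]
    calc ‖∫ x in Ω, ‖x‖ ^ 2 * (φ x * ψ x)‖
        ≤ ∫ x in Ω, (R ^ 2 / 2 * φ x ^ 2 + R ^ 2 / 2 * ψ x ^ 2) := by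
          refine norm_integral_le_of_norm_le ((iφ.const_mul _).add (iψ.const_mul _)) ?_
          refine (ae_restrict_iff' hΩo.measurableSet).2 (Filter.Eventually.of_forall ?_)
          intro x hx
          have hxR : ‖x‖ ≤ R := by simpa using hΩR hx
          have h2 : ‖x‖ ^ 2 ≤ R ^ 2 := by gcongr
          have h3 : |φ x * ψ x| ≤ (φ x ^ 2 + ψ x ^ 2) / 2 := by
            rw [abs_le]
            constructor <;> nlinarith [sq_nonneg (φ x + ψ x), sq_nonneg (φ x - ψ x)]
          rw [Real.norm_eq_abs, abs_mul, abs_of_nonneg (sq_nonneg ‖x‖)]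
          calc ‖x‖ ^ 2 * |φ x * ψ x| ≤ R ^ 2 * ((φ x ^ 2 + ψ x ^ 2) / 2) := by gcongr
            _ = _ := by ring
      _ = R ^ 2 := by
          rw [integral_add (iφ.const_mul _) (iψ.const_mul _), integral_const_mul,
            integral_const_mul, nφ, nψ]
          ring
  rw [hQ, hS]
  set T := ∫ x in Ω, ‖x‖ ^ 2 * (φ x * ψ x)
  set b := En ^ β with hb
  have hEn0 : 0 < En := by linarith
  have hb1 : 1 ≤ b := Real.one_le_rpow hEn1 hβ0
  have hb2 : b ^ 2 / En = En ^ (-(1 - 2 * β)) := by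
    rw [hb, ← Real.rpow_natCast, ← Real.rpow_mul hEn0.le]
    nth_rewrite 2 [← Real.rpow_one En]
    rw [← Real.rpow_sub hEn0]
    congr 1
    push_cast
    ring
  rw [← hb2] at hsmall
  have hdiff : (Eφ - Eψ) ^ 2 ≤ 4 * b ^ 2 := by
    rw [abs_le] at hEφ hEψ
    have := sq_le_sq' (a := Eφ - Eψ) (b := 2 * b) (by linarith) (by linarith)
    linarith [mul_pow 2 b 2]
  have hD2 : |(Eφ - Eψ) ^ 2 / 4 * T| ≤ b ^ 2 * R ^ 2 := by
    rw [abs_mul, abs_of_nonneg (by positivity)]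
    exact mul_le_mul (by linarith) hT (abs_nonneg _) (by positivity)
  set I : ℝ := if φ = ψ then 1 else 0 with hI
  have hI0 : |I| ≤ 1 := by rw [hI]; split_ifs <;> simp
  have hD1 : |(Eφ - En + (Eψ - En)) * I| ≤ 2 * b := by
    rw [abs_mul]
    calc |Eφ - En + (Eψ - En)| * |I| ≤ (2 * b) * 1 :=
          mul_le_mul ((abs_add_le _ _).trans (by linarith)) hI0 (abs_nonneg _) (by linarith)
      _ = 2 * b := mul_one _
  have e : ((Eφ + Eψ) * I + (Eφ - Eψ) ^ 2 / 4 * T) / (2 * En) - I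
      = ((Eφ - En + (Eψ - En)) * I + (Eφ - Eψ) ^ 2 / 4 * T) / (2 * En) := by
    field_simp
    ring
  rw [e, abs_div, abs_of_pos (by linarith : 0 < 2 * En)]
  refine le_trans ?_ hsmall.le
  rw [← mul_div_assoc, div_le_div_iff₀ (by linarith) hEn0]
  have h1 := (abs_add_le ((Eφ - En + (Eψ - En)) * I) ((Eφ - Eψ) ^ 2 / 4 * T)).trans
    (add_le_add hD1 hD2)
  have h2 : 2 * b + b ^ 2 * R ^ 2 ≤ 2 * ((1 + R ^ 2) * b ^ 2) := by
    have h3 : b ≤ b ^ 2 := by rw [sq]; exact le_mul_of_one_le_left (by linarith) hb1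
    have h4 : 0 ≤ b ^ 2 * R ^ 2 := by positivity
    linarith
  calc _ ≤ 2 * ((1 + R ^ 2) * b ^ 2) * En := by gcongr; exact h1.trans h2
    _ = _ := by ring
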